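/- Let J : ℝⁿ → ℝ be twice continuously differentiable with positive-definite Hessian ∇²J(x) ≻ 0 at every x, define V(x) = ½‖∇J(x)‖², and let λ : ℝ × ℝ → ℝ. Let x : ℝ → ℝⁿ be a differentiable trajectory with x'(t) = -λ(V(x(t)), t) · (∇²J(x(t)))⁻¹ ∇J(x(t)) for all t ≥ 0. Then for every t ≥ 0, (d/dt) V(x(t)) = -2 λ(V(x(t)), t) · V(x(t)) = -‖∇J(x(t))‖² λ(V(x(t)), t). -/

import Mathlib

open RealInnerProductSpace

theorem ContDiff.differentiable_gradient {E : Type*} [NormedAddCommGroup E]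
    [InnerProductSpace ℝ E] [CompleteSpace E] {J : E → ℝ} (hJ : ContDiff ℝ 2 J) :
    Differentiable ℝ (gradient J) := by
  have h : Differentiable ℝ (fderiv ℝ J) :=
    (hJ.fderiv_right (m := 1) (by norm_num)).differentiable (by norm_num)
  exact fun y => ((InnerProductSpace.toDual ℝ E).symm.toContinuousLinearEquiv.differentiableAt).comp
    y (h y)

theorem ContinuousLinearMap.apply_inverse_apply_of_injective {E : Type*} [NormedAddCommGroup E]
    [NormedSpace ℝ E] [FiniteDimensional ℝ E] {A : E →L[ℝ] E}
    (hA : Function.Injective A) (v : E) : A (A.inverse v) = v := by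
  let e : E ≃L[ℝ] E :=
    (LinearEquiv.ofInjectiveEndo (A : E →ₗ[ℝ] E) hA).toContinuousLinearEquiv
  have he : (e : E →L[ℝ] E) = A := by
    ext w
    rfl
  rw [← he, ContinuousLinearMap.inverse_equiv]
  simp

/-- Newton dynamics for unconstrained optimization (Example 3): for `J` twice
continuously differentiable with everywhere positive-definite Hessian, the
continuous-time Newton feedback `ẋ = -λ(V(x),t) [∇²J(x)]⁻¹ ∇J(x)` with
`V(x) = ½‖∇J(x)‖²` yields `V̇ = -2 λ V = -‖∇J(x)‖² λ`. -/
theorem newton_dynamics_unconstrained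
    (n : ℕ) (J : EuclideanSpace ℝ (Fin n) → ℝ) (hJ : ContDiff ℝ 2 J)
    (hpd : ∀ (y v : EuclideanSpace ℝ (Fin n)), v ≠ 0 →
      0 < ⟪v, fderiv ℝ (fun u => gradient J u) y v⟫)
    (V : EuclideanSpace ℝ (Fin n) → ℝ)
    (hV : ∀ y, V y = (1 / 2) * ‖gradient J y‖ ^ 2)
    (lam : ℝ → ℝ → ℝ)
    (x : ℝ → EuclideanSpace ℝ (Fin n)) (hx : Differentiable ℝ x)
    (hdyn : ∀ t, 0 ≤ t → deriv x t = (-(lam (V (x t)) t)) •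
      (fderiv ℝ (fun u => gradient J u) (x t)).inverse (gradient J (x t))) :
    ∀ t, 0 ≤ t →
      deriv (fun s => V (x s)) t = -2 * lam (V (x t)) t * V (x t) ∧
      deriv (fun s => V (x s)) t = -‖gradient J (x t)‖ ^ 2 * lam (V (x t)) t := by
  intro t ht
  have hg : HasDerivAt (fun s => gradient J (x s))
      (fderiv ℝ (gradient J) (x t) (deriv x t)) t :=
    (hJ.differentiable_gradient (x t)).hasFDerivAt.comp_hasDerivAt t (hx t).hasDerivAt
  have hinj : Function.Injective (fderiv ℝ (gradient J) (x t)) := by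
    refine (injective_iff_map_eq_zero _).2 fun v hv => ?_
    by_contra hne
    have h : 0 < ⟪v, fderiv ℝ (gradient J) (x t) v⟫ := hpd (x t) v hne
    simp [hv] at h
  have hnewton : fderiv ℝ (gradient J) (x t) (deriv x t) =
      (-(lam (V (x t)) t)) • gradient J (x t) := by
    rw [hdyn t ht, map_smul,
      ContinuousLinearMap.apply_inverse_apply_of_injective hinj]
  have hderiv : deriv (fun s => V (x s)) t = -‖gradient J (x t)‖ ^ 2 * lam (V (x t)) t := by
    have h := (hg.norm_sq.const_mul (1 / 2 : ℝ)).deriv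
    simp only [← hV] at h
    rw [h, hnewton, real_inner_smul_right, real_inner_self_eq_norm_sq]
    ring
  refine ⟨?_, hderiv⟩
  have hVx := hV (x t)
  linear_combination hderiv + 2 * lam (V (x t)) t * hVx
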